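/- arXiv:1901.10014 — 2 statements merged into one kernel-verified Lean document; each statement's English description precedes it below -/
import Mathlib

section
/- If b₁, b₂ ∈ B', q₁, q₁' ∈ Q₁, q₂, q₂' ∈ Q₂ and κ ∈ K satisfy κ·o·b₁·q₁·q₂·o⁻¹ = o·b₂·q₁'·q₂'·o⁻¹, then b₁ = b₂, q₁ = q₁' and q₂ = q₂' (and κ = 1); equivalently, the map B' × Q₁ × Q₂ → K\GL(a+b,k), (b, q₁, q₂) ↦ K·o·b·q₁·q₂·o⁻¹, is injective. -/
open Matrix

abbrev inBlk (off len i : ℕ) : Prop := off ≤ i ∧ i < off + len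

abbrev Jpos (roff coff len i j : ℕ) : Prop :=
  inBlk roff len i ∧ inBlk coff len j ∧ (i - roff) + (j - coff) = len - 1

abbrev Ipos (roff coff len i j : ℕ) : Prop :=
  inBlk roff len i ∧ inBlk coff len j ∧ i - roff = j - coff

/-- The matrix `o`: block rows `(q, p, t, p)`, block columns `(p, q, t, p)` with
`p = r + s`; nonzero blocks `(1,2)=1`, `(2,4)=1`, `(3,3)=1`, `(4,1)=J`, `(4,4)=1`. -/
def oMat (k : Type*) [Field k] (q r s t : ℕ) :
    Matrix (Fin (q + (r + s) + t + (r + s))) (Fin (q + (r + s) + t + (r + s))) k :=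
  Matrix.of fun i j =>
    if Ipos 0 (r + s) q (i : ℕ) (j : ℕ) ∨
       Ipos q ((r + s) + q + t) (r + s) (i : ℕ) (j : ℕ) ∨
       Ipos (q + (r + s)) ((r + s) + q) t (i : ℕ) (j : ℕ) ∨
       Jpos (q + (r + s) + t) 0 (r + s) (i : ℕ) (j : ℕ) ∨
       Ipos (q + (r + s) + t) ((r + s) + q + t) (r + s) (i : ℕ) (j : ℕ)
    then 1 else 0

/-- The group `B'` (block rows and columns `(p, q, t, p)`, `p = r+s`): block lower
triangular with diagonal blocks (invertible lower triangular, identity, identity,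
unipotent lower triangular), the `(3,2)` block zero, other below-diagonal blocks
arbitrary.  Equivalently: lower triangular, nonzero diagonal on `[0, p)`, identity
pattern on the middle `(q+t) × (q+t)` square, diagonal `1` on `[p+q+t, p+q+t+p)`. -/
def bPrime (k : Type*) [Field k] (q r s t : ℕ) :
    Set (Matrix (Fin (q + (r + s) + t + (r + s))) (Fin (q + (r + s) + t + (r + s))) k) :=
  {g | (∀ i j : Fin (q + (r + s) + t + (r + s)), (i : ℕ) < (j : ℕ) → g i j = 0) ∧
    (∀ i : Fin (q + (r + s) + t + (r + s)), (i : ℕ) < r + s → g i i ≠ 0) ∧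
    (∀ i j : Fin (q + (r + s) + t + (r + s)),
      inBlk (r + s) (q + t) (i : ℕ) → inBlk (r + s) (q + t) (j : ℕ) →
      g i j = if (i : ℕ) = (j : ℕ) then 1 else 0) ∧
    (∀ i : Fin (q + (r + s) + t + (r + s)), (r + s) + q + t ≤ (i : ℕ) → g i i = 1)}

/-- The group `Q₁`: identity except for an arbitrary `q × t` block in position `(2,3)`. -/
def qOne (k : Type*) [Field k] (q r s t : ℕ) :
    Set (Matrix (Fin (q + (r + s) + t + (r + s))) (Fin (q + (r + s) + t + (r + s))) k) :=
  {g | ∀ i j : Fin (q + (r + s) + t + (r + s)),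
    ¬ (inBlk (r + s) q (i : ℕ) ∧ inBlk ((r + s) + q) t (j : ℕ)) →
    g i j = if (i : ℕ) = (j : ℕ) then 1 else 0}

/-- The group `Q₂`: identity except for an arbitrary `t × q` block in position `(3,2)`. -/
def qTwo (k : Type*) [Field k] (q r s t : ℕ) :
    Set (Matrix (Fin (q + (r + s) + t + (r + s))) (Fin (q + (r + s) + t + (r + s))) k) :=
  {g | ∀ i j : Fin (q + (r + s) + t + (r + s)),
    ¬ (inBlk ((r + s) + q) t (i : ℕ) ∧ inBlk (r + s) q (j : ℕ)) →
    g i j = if (i : ℕ) = (j : ℕ) then 1 else 0}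

/-- The subgroup `K = diag(GL(a), GL(b))`, `a = q + (r+s)`, `b = t + (r+s)`, as a set of
matrices. -/
def kDiag (k : Type*) [Field k] (q r s t : ℕ) :
    Set (Matrix (Fin (q + (r + s) + t + (r + s))) (Fin (q + (r + s) + t + (r + s))) k) :=
  {g | IsUnit g ∧ ∀ i j : Fin (q + (r + s) + t + (r + s)),
    (((i : ℕ) < q + (r + s) ∧ q + (r + s) ≤ (j : ℕ)) ∨
      (q + (r + s) ≤ (i : ℕ) ∧ (j : ℕ) < q + (r + s))) → g i j = 0}

namespace S8

variable {k : Type*} [Field k] {q r s t : ℕ}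

abbrev N (q r s t : ℕ) := Fin (q + (r + s) + t + (r + s))

def c1 (q r s t : ℕ) (i : Fin (r + s)) : N q r s t := ⟨i, by omega⟩
def c2 (q r s t : ℕ) (i : Fin q) : N q r s t := ⟨(r + s) + i, by omega⟩
def c3 (q r s t : ℕ) (i : Fin t) : N q r s t := ⟨(r + s) + q + i, by omega⟩
def c4 (q r s t : ℕ) (i : Fin (r + s)) : N q r s t := ⟨(r + s) + q + t + i, by omega⟩
def r1 (q r s t : ℕ) (i : Fin q) : N q r s t := ⟨i, by omega⟩
def r2 (q r s t : ℕ) (i : Fin (r + s)) : N q r s t := ⟨q + i, by omega⟩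

theorem cases_c (i : N q r s t) : (∃ j, i = c1 q r s t j) ∨ (∃ j, i = c2 q r s t j) ∨
    (∃ j, i = c3 q r s t j) ∨ (∃ j, i = c4 q r s t j) := by
  obtain ⟨i, hi⟩ := i
  by_cases h1 : i < r + s
  · exact Or.inl ⟨⟨i, h1⟩, rfl⟩
  by_cases h2 : i < r + s + q
  · exact Or.inr (Or.inl ⟨⟨i - (r + s), by omega⟩, by ext; simp only [c2]; omega⟩)
  by_cases h3 : i < r + s + q + t
  · exact Or.inr (Or.inr (Or.inl ⟨⟨i - (r + s + q), by omega⟩, by ext; simp only [c3]; omega⟩))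
  · exact Or.inr (Or.inr (Or.inr ⟨⟨i - (r + s + q + t), by omega⟩, by ext; simp only [c4]; omega⟩))

theorem cases_r (i : N q r s t) : (∃ j, i = r1 q r s t j) ∨ (∃ j, i = r2 q r s t j) ∨
    (∃ j, i = c3 q r s t j) ∨ (∃ j, i = c4 q r s t j) := by
  obtain ⟨i, hi⟩ := i
  by_cases h1 : i < q
  · exact Or.inl ⟨⟨i, h1⟩, rfl⟩
  by_cases h2 : i < r + s + q
  · exact Or.inr (Or.inl ⟨⟨i - q, by omega⟩, by ext; simp only [r2]; omega⟩)
  by_cases h3 : i < r + s + q + t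
  · exact Or.inr (Or.inr (Or.inl ⟨⟨i - (r + s + q), by omega⟩, by ext; simp only [c3]; omega⟩))
  · exact Or.inr (Or.inr (Or.inr ⟨⟨i - (r + s + q + t), by omega⟩, by ext; simp only [c4]; omega⟩))

theorem sum_c (f : N q r s t → k) : ∑ i, f i = (∑ i, f (c1 q r s t i)) + (∑ i, f (c2 q r s t i)) +
    (∑ i, f (c3 q r s t i)) + ∑ i, f (c4 q r s t i) := by
  have hb : Function.Bijective
      (Sum.elim (Sum.elim (c1 q r s t) (c2 q r s t)) (Sum.elim (c3 q r s t) (c4 q r s t))) := by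
    constructor
    · rintro ((i | i) | (i | i)) ((j | j) | (j | j)) h <;>
        simp only [Sum.elim_inl, Sum.elim_inr, c1, c2, c3, c4, Fin.mk.injEq] at h <;>
        first
        | omega
        | (have : i = j := by ext; omega
           rw [this])
    · intro i
      rcases cases_c i with ⟨j, h⟩ | ⟨j, h⟩ | ⟨j, h⟩ | ⟨j, h⟩
      · exact ⟨Sum.inl (Sum.inl j), h.symm⟩
      · exact ⟨Sum.inl (Sum.inr j), h.symm⟩
      · exact ⟨Sum.inr (Sum.inl j), h.symm⟩
      · exact ⟨Sum.inr (Sum.inr j), h.symm⟩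
  rw [← (Equiv.ofBijective _ hb).sum_comp]
  simp [Fintype.sum_sum_type, add_assoc]

theorem sum_r (f : N q r s t → k) : ∑ i, f i = (∑ i, f (r1 q r s t i)) + (∑ i, f (r2 q r s t i)) +
    (∑ i, f (c3 q r s t i)) + ∑ i, f (c4 q r s t i) := by
  have hb : Function.Bijective
      (Sum.elim (Sum.elim (r1 q r s t) (r2 q r s t)) (Sum.elim (c3 q r s t) (c4 q r s t))) := by
    constructor
    · rintro ((i | i) | (i | i)) ((j | j) | (j | j)) h <;>
        simp only [Sum.elim_inl, Sum.elim_inr, r1, r2, c3, c4, Fin.mk.injEq] at h <;>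
        first
        | omega
        | (have : i = j := by ext; omega
           rw [this])
    · intro i
      rcases cases_r i with ⟨j, h⟩ | ⟨j, h⟩ | ⟨j, h⟩ | ⟨j, h⟩
      · exact ⟨Sum.inl (Sum.inl j), h.symm⟩
      · exact ⟨Sum.inl (Sum.inr j), h.symm⟩
      · exact ⟨Sum.inr (Sum.inl j), h.symm⟩
      · exact ⟨Sum.inr (Sum.inr j), h.symm⟩
  rw [← (Equiv.ofBijective _ hb).sum_comp]
  simp [Fintype.sum_sum_type, add_assoc]

theorem mul_c {m l m' l' : Type*} (P : Matrix m (N q r s t) k) (Q : Matrix (N q r s t) l k)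
    (x : m' → m) (y : l' → l) : (P * Q).submatrix x y =
    P.submatrix x (c1 q r s t) * Q.submatrix (c1 q r s t) y +
    P.submatrix x (c2 q r s t) * Q.submatrix (c2 q r s t) y +
    P.submatrix x (c3 q r s t) * Q.submatrix (c3 q r s t) y +
    P.submatrix x (c4 q r s t) * Q.submatrix (c4 q r s t) y := by
  ext i j
  simp [Matrix.mul_apply, sum_c]

theorem mul_r {m l m' l' : Type*} (P : Matrix m (N q r s t) k) (Q : Matrix (N q r s t) l k)
    (x : m' → m) (y : l' → l) : (P * Q).submatrix x y =
    P.submatrix x (r1 q r s t) * Q.submatrix (r1 q r s t) y +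
    P.submatrix x (r2 q r s t) * Q.submatrix (r2 q r s t) y +
    P.submatrix x (c3 q r s t) * Q.submatrix (c3 q r s t) y +
    P.submatrix x (c4 q r s t) * Q.submatrix (c4 q r s t) y := by
  ext i j
  simp [Matrix.mul_apply, sum_r]

theorem ext_c {P Q : Matrix (N q r s t) (N q r s t) k}
    (h1 : P.submatrix (c1 q r s t) id = Q.submatrix (c1 q r s t) id)
    (h2 : P.submatrix (c2 q r s t) id = Q.submatrix (c2 q r s t) id)
    (h3 : P.submatrix (c3 q r s t) id = Q.submatrix (c3 q r s t) id)
    (h4 : P.submatrix (c4 q r s t) id = Q.submatrix (c4 q r s t) id) : P = Q := by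
  ext i j
  rcases cases_c i with ⟨i, rfl⟩ | ⟨i, rfl⟩ | ⟨i, rfl⟩ | ⟨i, rfl⟩
  · exact congrFun (congrFun h1 i) j
  · exact congrFun (congrFun h2 i) j
  · exact congrFun (congrFun h3 i) j
  · exact congrFun (congrFun h4 i) j

/-- rows of `o * X` -/
theorem o_r1 {l l' : Type*} (X : Matrix (N q r s t) l k) (y : l' → l) :
    (oMat k q r s t * X).submatrix (r1 q r s t) y = X.submatrix (c2 q r s t) y := by
  have e1 : (oMat k q r s t).submatrix (r1 q r s t) (c1 q r s t) = 0 := by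
    ext i j; simp [oMat, r1, c1]; omega
  have e2 : (oMat k q r s t).submatrix (r1 q r s t) (c2 q r s t) = 1 := by
    ext i j; simp [oMat, r1, c2, Matrix.one_apply, Fin.ext_iff]; congr 1; apply propext; omega
  have e3 : (oMat k q r s t).submatrix (r1 q r s t) (c3 q r s t) = 0 := by
    ext i j; simp [oMat, r1, c3]; omega
  have e4 : (oMat k q r s t).submatrix (r1 q r s t) (c4 q r s t) = 0 := by
    ext i j; simp [oMat, r1, c4]; omega
  rw [mul_c, e1, e2, e3, e4]; simp

theorem o_r2 {l l' : Type*} (X : Matrix (N q r s t) l k) (y : l' → l) :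
    (oMat k q r s t * X).submatrix (r2 q r s t) y = X.submatrix (c4 q r s t) y := by
  have e1 : (oMat k q r s t).submatrix (r2 q r s t) (c1 q r s t) = 0 := by
    ext i j; simp [oMat, r2, c1]; omega
  have e2 : (oMat k q r s t).submatrix (r2 q r s t) (c2 q r s t) = 0 := by
    ext i j; simp [oMat, r2, c2]; omega
  have e3 : (oMat k q r s t).submatrix (r2 q r s t) (c3 q r s t) = 0 := by
    ext i j; simp [oMat, r2, c3]; omega
  have e4 : (oMat k q r s t).submatrix (r2 q r s t) (c4 q r s t) = 1 := by
    ext i j; simp [oMat, r2, c4, Matrix.one_apply, Fin.ext_iff]; congr 1; apply propext; omega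
  rw [mul_c, e1, e2, e3, e4]; simp

theorem o_r3 {l l' : Type*} (X : Matrix (N q r s t) l k) (y : l' → l) :
    (oMat k q r s t * X).submatrix (c3 q r s t) y = X.submatrix (c3 q r s t) y := by
  have e1 : (oMat k q r s t).submatrix (c3 q r s t) (c1 q r s t) = 0 := by
    ext i j; simp [oMat, c3, c1]; omega
  have e2 : (oMat k q r s t).submatrix (c3 q r s t) (c2 q r s t) = 0 := by
    ext i j; simp [oMat, c3, c2]; omega
  have e3 : (oMat k q r s t).submatrix (c3 q r s t) (c3 q r s t) = 1 := by
    ext i j; simp [oMat, c3, Matrix.one_apply, Fin.ext_iff]; congr 1; apply propext; omega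
  have e4 : (oMat k q r s t).submatrix (c3 q r s t) (c4 q r s t) = 0 := by
    ext i j; simp [oMat, c3, c4]; omega
  rw [mul_c, e1, e2, e3, e4]; simp

theorem o_r4 {l l' : Type*} (X : Matrix (N q r s t) l k) (y : l' → l) :
    (oMat k q r s t * X).submatrix (c4 q r s t) y =
      (X.submatrix (c1 q r s t) y).submatrix Fin.rev id + X.submatrix (c4 q r s t) y := by
  have e1 : (oMat k q r s t).submatrix (c4 q r s t) (c1 q r s t) =
      (1 : Matrix (Fin (r + s)) (Fin (r + s)) k).submatrix Fin.rev id := by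
    ext i j; simp [oMat, c4, c1, Matrix.one_apply, Fin.ext_iff]; congr 1; apply propext; omega
  have e2 : (oMat k q r s t).submatrix (c4 q r s t) (c2 q r s t) = 0 := by
    ext i j; simp [oMat, c4, c2]; omega
  have e3 : (oMat k q r s t).submatrix (c4 q r s t) (c3 q r s t) = 0 := by
    ext i j; simp [oMat, c4, c3]; omega
  have e4 : (oMat k q r s t).submatrix (c4 q r s t) (c4 q r s t) = 1 := by
    ext i j; simp [oMat, c4, Matrix.one_apply, Fin.ext_iff]; congr 1; apply propext; omega
  rw [mul_c, e1, e2, e3, e4]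
  simp only [Matrix.zero_mul, add_zero, Matrix.one_mul]
  congr 1
  ext i j
  simp [Matrix.mul_apply, Matrix.one_apply]

theorem o_unit : IsUnit (oMat k q r s t) := by
  rw [← Matrix.mulVec_injective_iff_isUnit]
  intro v w h
  have key : oMat k q r s t * Matrix.replicateCol Unit (v - w) = 0 := by
    rw [← Matrix.replicateCol_mulVec, Matrix.mulVec_sub, sub_eq_zero.2 h]; rfl
  have h2 := o_r1 (Matrix.replicateCol Unit (v - w)) (id : Unit → Unit)
  have h4 := o_r2 (Matrix.replicateCol Unit (v - w)) (id : Unit → Unit)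
  have h3 := o_r3 (Matrix.replicateCol Unit (v - w)) (id : Unit → Unit)
  have h1 := o_r4 (Matrix.replicateCol Unit (v - w)) (id : Unit → Unit)
  rw [← h4] at h1
  rw [key] at h1 h2 h3 h4
  ext i
  rw [← sub_eq_zero]
  rcases cases_c i with ⟨i, rfl⟩ | ⟨i, rfl⟩ | ⟨i, rfl⟩ | ⟨i, rfl⟩
  · simpa using (congrFun (congrFun h1 i.rev) ()).symm
  · exact (congrFun (congrFun h2 i) ()).symm
  · exact (congrFun (congrFun h3 i) ()).symm
  · exact (congrFun (congrFun h4 i) ()).symm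

/-- Blocks of `X = b * q₁ * q₂`. -/
theorem b_row1 {b : Matrix (N q r s t) (N q r s t) k} (hb : b ∈ bPrime k q r s t) :
    b.submatrix (c1 q r s t) (c2 q r s t) = 0 ∧ b.submatrix (c1 q r s t) (c3 q r s t) = 0 ∧
    b.submatrix (c1 q r s t) (c4 q r s t) = 0 := by
  obtain ⟨h, -⟩ := hb
  refine ⟨?_, ?_, ?_⟩ <;> ext i j <;> apply h <;> simp only [c1, c2, c3, c4] <;> omega

theorem b_row2 {b : Matrix (N q r s t) (N q r s t) k} (hb : b ∈ bPrime k q r s t) :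
    b.submatrix (c2 q r s t) (c2 q r s t) = 1 ∧ b.submatrix (c2 q r s t) (c3 q r s t) = 0 ∧
    b.submatrix (c2 q r s t) (c4 q r s t) = 0 := by
  obtain ⟨h, -, h', -⟩ := hb
  refine ⟨?_, ?_, ?_⟩ <;> ext i j
  · rw [Matrix.submatrix_apply, h' _ _ (by simp only [c2]; omega) (by simp only [c2]; omega)]
    simp [c2, Matrix.one_apply, Fin.ext_iff]
  all_goals apply h; simp only [c2, c3, c4]; omega

theorem b_row3 {b : Matrix (N q r s t) (N q r s t) k} (hb : b ∈ bPrime k q r s t) :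
    b.submatrix (c3 q r s t) (c2 q r s t) = 0 ∧ b.submatrix (c3 q r s t) (c3 q r s t) = 1 ∧
    b.submatrix (c3 q r s t) (c4 q r s t) = 0 := by
  obtain ⟨h, -, h', -⟩ := hb
  refine ⟨?_, ?_, ?_⟩ <;> ext i j
  · rw [Matrix.submatrix_apply, h' _ _ (by simp only [c3]; omega) (by simp only [c2]; omega)]
    exact if_neg (by simp only [c2, c3]; omega)
  · rw [Matrix.submatrix_apply, h' _ _ (by simp only [c3]; omega) (by simp only [c3]; omega)]
    simp [c3, Matrix.one_apply, Fin.ext_iff]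
  · apply h; simp only [c3, c4]; omega

theorem q1_blk {g : Matrix (N q r s t) (N q r s t) k} (hg : g ∈ qOne k q r s t) :
    (g.submatrix (c1 q r s t) (c1 q r s t) = 1 ∧ g.submatrix (c1 q r s t) (c2 q r s t) = 0 ∧
    g.submatrix (c1 q r s t) (c3 q r s t) = 0 ∧ g.submatrix (c1 q r s t) (c4 q r s t) = 0) ∧
    (g.submatrix (c2 q r s t) (c1 q r s t) = 0 ∧ g.submatrix (c2 q r s t) (c2 q r s t) = 1 ∧
    g.submatrix (c2 q r s t) (c4 q r s t) = 0) ∧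
    (g.submatrix (c3 q r s t) (c1 q r s t) = 0 ∧ g.submatrix (c3 q r s t) (c2 q r s t) = 0 ∧
    g.submatrix (c3 q r s t) (c3 q r s t) = 1 ∧ g.submatrix (c3 q r s t) (c4 q r s t) = 0) ∧
    (g.submatrix (c4 q r s t) (c1 q r s t) = 0 ∧ g.submatrix (c4 q r s t) (c2 q r s t) = 0 ∧
    g.submatrix (c4 q r s t) (c3 q r s t) = 0 ∧ g.submatrix (c4 q r s t) (c4 q r s t) = 1) := by
  refine ⟨⟨?_, ?_, ?_, ?_⟩, ⟨?_, ?_, ?_⟩, ⟨?_, ?_, ?_, ?_⟩, ⟨?_, ?_, ?_, ?_⟩⟩ <;> ext i j <;>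
    rw [Matrix.submatrix_apply, hg _ _ (by simp only [c1, c2, c3, c4]; omega)] <;>
    simp only [c1, c2, c3, c4, Matrix.one_apply, Matrix.zero_apply, Fin.ext_iff] <;>
    first | exact if_neg (by omega) | exact if_congr (by omega) rfl rfl

theorem q2_blk {g : Matrix (N q r s t) (N q r s t) k} (hg : g ∈ qTwo k q r s t) :
    (g.submatrix (c1 q r s t) (c1 q r s t) = 1 ∧ g.submatrix (c1 q r s t) (c2 q r s t) = 0 ∧
    g.submatrix (c1 q r s t) (c3 q r s t) = 0 ∧ g.submatrix (c1 q r s t) (c4 q r s t) = 0) ∧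
    (g.submatrix (c2 q r s t) (c1 q r s t) = 0 ∧ g.submatrix (c2 q r s t) (c2 q r s t) = 1 ∧
    g.submatrix (c2 q r s t) (c3 q r s t) = 0 ∧ g.submatrix (c2 q r s t) (c4 q r s t) = 0) ∧
    (g.submatrix (c3 q r s t) (c1 q r s t) = 0 ∧
    g.submatrix (c3 q r s t) (c3 q r s t) = 1 ∧ g.submatrix (c3 q r s t) (c4 q r s t) = 0) ∧
    (g.submatrix (c4 q r s t) (c1 q r s t) = 0 ∧ g.submatrix (c4 q r s t) (c2 q r s t) = 0 ∧
    g.submatrix (c4 q r s t) (c3 q r s t) = 0 ∧ g.submatrix (c4 q r s t) (c4 q r s t) = 1) := by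
  refine ⟨⟨?_, ?_, ?_, ?_⟩, ⟨?_, ?_, ?_, ?_⟩, ⟨?_, ?_, ?_⟩, ⟨?_, ?_, ?_, ?_⟩⟩ <;> ext i j <;>
    rw [Matrix.submatrix_apply, hg _ _ (by simp only [c1, c2, c3, c4]; omega)] <;>
    simp only [c1, c2, c3, c4, Matrix.one_apply, Matrix.zero_apply, Fin.ext_iff] <;>
    first | exact if_neg (by omega) | exact if_congr (by omega) rfl rfl

/-- columns of `Y * q₁ * q₂` -/
theorem col_X {m m' : Type*} {g h : Matrix (N q r s t) (N q r s t) k} (hg : g ∈ qOne k q r s t)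
    (hh : h ∈ qTwo k q r s t) (Y : Matrix m (N q r s t) k) (x : m' → m) :
    (Y * g * h).submatrix x (c1 q r s t) = Y.submatrix x (c1 q r s t) ∧
    (Y * g * h).submatrix x (c4 q r s t) = Y.submatrix x (c4 q r s t) ∧
    (Y * g * h).submatrix x (c3 q r s t) = Y.submatrix x (c2 q r s t) *
      g.submatrix (c2 q r s t) (c3 q r s t) + Y.submatrix x (c3 q r s t) ∧
    (Y * g * h).submatrix x (c2 q r s t) = Y.submatrix x (c2 q r s t) +
     (Y.submatrix x (c2 q r s t) *
      g.submatrix (c2 q r s t) (c3 q r s t) + Y.submatrix x (c3 q r s t)) *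
      h.submatrix (c3 q r s t) (c2 q r s t) := by
  obtain ⟨⟨a1, a2, a3, a4⟩, ⟨a5, a6, a7⟩, ⟨a8, a9, a10, a11⟩, ⟨a12, a13, a14, a15⟩⟩ := q1_blk hg
  obtain ⟨⟨b1, b2, b3, b4⟩, ⟨b5, b6, b6', b7⟩, ⟨b8, b10, b11⟩, ⟨b12, b13, b14, b15⟩⟩ := q2_blk hh
  refine ⟨?_, ?_, ?_, ?_⟩ <;> simp [mul_c, *]

theorem k_blk {g : Matrix (N q r s t) (N q r s t) k} (hg : g ∈ kDiag k q r s t) :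
    (g.submatrix (r1 q r s t) (c3 q r s t) = 0 ∧ g.submatrix (r1 q r s t) (c4 q r s t) = 0) ∧
    (g.submatrix (r2 q r s t) (c3 q r s t) = 0 ∧ g.submatrix (r2 q r s t) (c4 q r s t) = 0) ∧
    (g.submatrix (c3 q r s t) (r1 q r s t) = 0 ∧ g.submatrix (c3 q r s t) (r2 q r s t) = 0) ∧
    (g.submatrix (c4 q r s t) (r1 q r s t) = 0 ∧ g.submatrix (c4 q r s t) (r2 q r s t) = 0) := by
  refine ⟨⟨?_, ?_⟩, ⟨?_, ?_⟩, ⟨?_, ?_⟩, ⟨?_, ?_⟩⟩ <;> ext i j <;>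
    apply hg.2 <;> simp only [r1, r2, c3, c4] <;> omega

theorem tri_unit {p : ℕ} {U : Matrix (Fin p) (Fin p) k}
    (hU : ∀ i j, i < j → U i j = 0) (h : ∀ i, U i i ≠ 0) : IsUnit U.det := by
  rw [Matrix.det_of_lowerTriangular U (fun i j hij => hU i j hij)]
  rw [isUnit_iff_ne_zero]
  exact Finset.prod_ne_zero_iff.2 fun i _ => h i

theorem tri_of_mul {p : ℕ} {U U' L : Matrix (Fin p) (Fin p) k}
    (hU : ∀ i j, i < j → U i j = 0) (hU' : ∀ i j, i < j → U' i j = 0) (h : ∀ i, U i i ≠ 0)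
    (e : L * U = U') : ∀ i j, i < j → L i j = 0 := by
  have hd := tri_unit hU h
  have : Invertible U := Matrix.invertibleOfIsUnitDet U hd
  have e2 : L = U' * U⁻¹ := by rw [← e, Matrix.mul_nonsing_inv_cancel_right _ _ hd]
  have hT : Matrix.BlockTriangular U OrderDual.toDual := fun i j hij => hU i j hij
  have hT' : Matrix.BlockTriangular U' OrderDual.toDual := fun i j hij => hU' i j hij
  have := hT'.mul (Matrix.blockTriangular_inv_of_blockTriangular hT)
  rw [← e2] at this
  intro i j hij
  exact this hij

theorem theta_one {p : ℕ} {U U' T T' θ : Matrix (Fin p) (Fin p) k}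
    (hU : ∀ i j, i < j → U i j = 0) (hU' : ∀ i j, i < j → U' i j = 0) (h : ∀ i, U i i = 1)
    (h' : ∀ i, U' i i = 1)
    (hT : ∀ i j, i < j → T i j = 0) (hT' : ∀ i j, i < j → T' i j = 0) (hd : ∀ i, T i i ≠ 0)
    (e : θ * U = U') (e' : θ * T.submatrix Fin.rev id = T'.submatrix Fin.rev id) : θ = 1 := by
  have l1 := tri_of_mul hU hU' (fun i => by rw [h i]; exact one_ne_zero) e
  have e2 : θ.submatrix Fin.rev Fin.rev * T = T' := by
    ext i j
    have := congrFun (congrFun e' i.rev) j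
    simp only [Matrix.mul_apply, Matrix.submatrix_apply, Fin.rev_rev, id] at this ⊢
    rw [← this, ← Equiv.sum_comp Fin.revPerm]
    simp
  have l2 := tri_of_mul hT hT' hd e2
  have l3 : ∀ i j, j < i → θ i j = 0 := by
    intro i j hij
    have := l2 i.rev j.rev (by simpa using hij)
    simpa using this
  ext i j
  rcases lt_trichotomy i j with hij | rfl | hij
  · rw [l1 i j hij, Matrix.one_apply_ne hij.ne]
  · have := congrFun (congrFun e i) i
    rw [Matrix.mul_apply, Finset.sum_eq_single i, h, h', mul_one] at this
    · rw [this, Matrix.one_apply_eq]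
    · intro j _ hj
      rcases lt_or_gt_of_ne hj with hj | hj
      · rw [l3 _ _ hj, zero_mul]
      · rw [l1 _ _ hj, zero_mul]
    · simp
  · rw [l3 i j hij, Matrix.one_apply_ne hij.ne']

theorem E_rows {X Y κ : Matrix (N q r s t) (N q r s t) k} (hκ : κ ∈ kDiag k q r s t)
    (E : κ * (oMat k q r s t * X) = oMat k q r s t * Y) {l : Type*} (y : l → N q r s t) :
    (κ.submatrix (r1 q r s t) (r1 q r s t) * X.submatrix (c2 q r s t) y +
      κ.submatrix (r1 q r s t) (r2 q r s t) * X.submatrix (c4 q r s t) y =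
      Y.submatrix (c2 q r s t) y) ∧
    (κ.submatrix (r2 q r s t) (r1 q r s t) * X.submatrix (c2 q r s t) y +
      κ.submatrix (r2 q r s t) (r2 q r s t) * X.submatrix (c4 q r s t) y =
      Y.submatrix (c4 q r s t) y) ∧
    (κ.submatrix (c3 q r s t) (c3 q r s t) * X.submatrix (c3 q r s t) y +
      κ.submatrix (c3 q r s t) (c4 q r s t) * ((X.submatrix (c1 q r s t) y).submatrix Fin.rev id +
        X.submatrix (c4 q r s t) y) =
      Y.submatrix (c3 q r s t) y) ∧
    (κ.submatrix (c4 q r s t) (c3 q r s t) * X.submatrix (c3 q r s t) y +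
      κ.submatrix (c4 q r s t) (c4 q r s t) * ((X.submatrix (c1 q r s t) y).submatrix Fin.rev id +
        X.submatrix (c4 q r s t) y) =
      (Y.submatrix (c1 q r s t) y).submatrix Fin.rev id + Y.submatrix (c4 q r s t) y) := by
  obtain ⟨⟨k1, k2⟩, ⟨k3, k4⟩, ⟨k5, k6⟩, ⟨k7, k8⟩⟩ := k_blk hκ
  refine ⟨?_, ?_, ?_, ?_⟩
  · rw [← o_r1 Y, ← E, mul_r, k1, k2, o_r1, o_r2]; simp
  · rw [← o_r2 Y, ← E, mul_r, k3, k4, o_r1, o_r2]; simp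
  · rw [← o_r3 Y, ← E, mul_r, k5, k6, o_r3, o_r4]; simp
  · rw [← o_r4 Y, ← E, mul_r, k7, k8, o_r3, o_r4]; simp

theorem cancel_right {m p : Type*} [Fintype p] [DecidableEq p] {U : Matrix p p k}
    (hU : IsUnit U.det) {P Q : Matrix m p k} (h : P * U = Q * U) : P = Q := by
  rw [← Matrix.mul_nonsing_inv_cancel_right U P hU, h, Matrix.mul_nonsing_inv_cancel_right U Q hU]

theorem ext_blk {P Q : Matrix (N q r s t) (N q r s t) k} {l1 l2 l3 l4 : Type*}
    {y1 : l1 → N q r s t} {y2 : l2 → N q r s t} {y3 : l3 → N q r s t} {y4 : l4 → N q r s t}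
    (hy : ∀ i, (∃ j, i = y1 j) ∨ (∃ j, i = y2 j) ∨ (∃ j, i = y3 j) ∨ (∃ j, i = y4 j))
    (h1 : P.submatrix y1 y1 = Q.submatrix y1 y1 ∧ P.submatrix y1 y2 = Q.submatrix y1 y2 ∧
      P.submatrix y1 y3 = Q.submatrix y1 y3 ∧ P.submatrix y1 y4 = Q.submatrix y1 y4)
    (h2 : P.submatrix y2 y1 = Q.submatrix y2 y1 ∧ P.submatrix y2 y2 = Q.submatrix y2 y2 ∧
      P.submatrix y2 y3 = Q.submatrix y2 y3 ∧ P.submatrix y2 y4 = Q.submatrix y2 y4)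
    (h3 : P.submatrix y3 y1 = Q.submatrix y3 y1 ∧ P.submatrix y3 y2 = Q.submatrix y3 y2 ∧
      P.submatrix y3 y3 = Q.submatrix y3 y3 ∧ P.submatrix y3 y4 = Q.submatrix y3 y4)
    (h4 : P.submatrix y4 y1 = Q.submatrix y4 y1 ∧ P.submatrix y4 y2 = Q.submatrix y4 y2 ∧
      P.submatrix y4 y3 = Q.submatrix y4 y3 ∧ P.submatrix y4 y4 = Q.submatrix y4 y4) : P = Q := by
  obtain ⟨a1, a2, a3, a4⟩ := h1
  obtain ⟨a5, a6, a7, a8⟩ := h2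
  obtain ⟨a9, a10, a11, a12⟩ := h3
  obtain ⟨a13, a14, a15, a16⟩ := h4
  ext i j
  rcases hy i with ⟨i, rfl⟩ | ⟨i, rfl⟩ | ⟨i, rfl⟩ | ⟨i, rfl⟩ <;>
  rcases hy j with ⟨j, rfl⟩ | ⟨j, rfl⟩ | ⟨j, rfl⟩ | ⟨j, rfl⟩ <;>
  rw [← Matrix.submatrix_apply P, ← Matrix.submatrix_apply Q] <;> simp only [*]

theorem one_blk : ((1 : Matrix (N q r s t) (N q r s t) k).submatrix (r1 q r s t) (r1 q r s t) = 1) ∧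
    ((1 : Matrix (N q r s t) (N q r s t) k).submatrix (r1 q r s t) (r2 q r s t) = 0) ∧
    ((1 : Matrix (N q r s t) (N q r s t) k).submatrix (r2 q r s t) (r1 q r s t) = 0) ∧
    ((1 : Matrix (N q r s t) (N q r s t) k).submatrix (r2 q r s t) (r2 q r s t) = 1) ∧
    ((1 : Matrix (N q r s t) (N q r s t) k).submatrix (c3 q r s t) (c3 q r s t) = 1) ∧
    ((1 : Matrix (N q r s t) (N q r s t) k).submatrix (c3 q r s t) (c4 q r s t) = 0) ∧
    ((1 : Matrix (N q r s t) (N q r s t) k).submatrix (c4 q r s t) (c3 q r s t) = 0) ∧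
    ((1 : Matrix (N q r s t) (N q r s t) k).submatrix (c4 q r s t) (c4 q r s t) = 1) := by
  refine ⟨?_, ?_, ?_, ?_, ?_, ?_, ?_, ?_⟩ <;> ext i j <;>
    simp only [r1, r2, c3, c4, Matrix.submatrix_apply, Matrix.one_apply, Matrix.zero_apply,
      Fin.ext_iff] <;>
    split_ifs <;> first | rfl | omega

theorem one_mem : (1 : Matrix (N q r s t) (N q r s t) k) ∈ kDiag k q r s t := by
  refine ⟨isUnit_one, fun i j h => Matrix.one_apply_ne ?_⟩
  rintro rfl
  omega

theorem main (b₁ b₂ q₁ q₁' q₂ q₂' κ : Matrix (N q r s t) (N q r s t) k)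
    (hb : b₁ ∈ bPrime k q r s t) (hb' : b₂ ∈ bPrime k q r s t)
    (hq : q₁ ∈ qOne k q r s t) (hq' : q₁' ∈ qOne k q r s t)
    (hh : q₂ ∈ qTwo k q r s t) (hh' : q₂' ∈ qTwo k q r s t) (hκ : κ ∈ kDiag k q r s t)
    (E : κ * (oMat k q r s t * (b₁ * q₁ * q₂)) = oMat k q r s t * (b₂ * q₁' * q₂')) :
    b₁ = b₂ ∧ q₁ = q₁' ∧ q₂ = q₂' ∧ κ = 1 := by
  obtain ⟨p12, p13, p14⟩ := b_row1 hb
  obtain ⟨p22, p23, p24⟩ := b_row2 hb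
  obtain ⟨p32, p33, p34⟩ := b_row3 hb
  obtain ⟨s12, s13, s14⟩ := b_row1 hb'
  obtain ⟨s22, s23, s24⟩ := b_row2 hb'
  obtain ⟨s32, s33, s34⟩ := b_row3 hb'
  have ltU : ∀ {b : Matrix (N q r s t) (N q r s t) k}, b ∈ bPrime k q r s t → ∀ i j, i < j →
      b.submatrix (c4 q r s t) (c4 q r s t) i j = 0 := by
    intro b hb i j hij
    apply hb.1; simp only [c4]; omega
  have dgU : ∀ {b : Matrix (N q r s t) (N q r s t) k}, b ∈ bPrime k q r s t → ∀ i,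
      b.submatrix (c4 q r s t) (c4 q r s t) i i = 1 := by
    intro b hb i
    apply hb.2.2.2; simp only [c4]; omega
  have ltT : ∀ {b : Matrix (N q r s t) (N q r s t) k}, b ∈ bPrime k q r s t → ∀ i j, i < j →
      b.submatrix (c1 q r s t) (c1 q r s t) i j = 0 := by
    intro b hb i j hij
    apply hb.1; simp only [c1]; omega
  have dgT : ∀ {b : Matrix (N q r s t) (N q r s t) k}, b ∈ bPrime k q r s t → ∀ i,
      b.submatrix (c1 q r s t) (c1 q r s t) i i ≠ 0 := by
    intro b hb i
    apply hb.2.1; simp only [c1]; omega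
  have uU : IsUnit (b₁.submatrix (c4 q r s t) (c4 q r s t)).det :=
    tri_unit (ltU hb) (fun i => by rw [dgU hb i]; exact one_ne_zero)
  have colA : ∀ {m' : Type} (x : m' → N q r s t), _ := fun {m'} x => col_X hq hh b₁ x
  have colB : ∀ {m' : Type} (x : m' → N q r s t), _ := fun {m'} x => col_X hq' hh' b₂ x
  -- fourth column
  obtain ⟨e14, e24, e34, e44⟩ := E_rows hκ E (c4 q r s t)
  simp only [(colA _).2.1, (colB _).2.1, p14, p24, p34, s14, s24, s34, Matrix.mul_zero, zero_add,
    Matrix.submatrix_zero, Pi.zero_apply] at e14 e24 e34 e44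
  have β0 : κ.submatrix (r1 q r s t) (r2 q r s t) = 0 :=
    cancel_right uU (by rw [e14, Matrix.zero_mul])
  have ζ0 : κ.submatrix (c3 q r s t) (c4 q r s t) = 0 :=
    cancel_right uU (by rw [e34, Matrix.zero_mul])
  have δθ : κ.submatrix (r2 q r s t) (r2 q r s t) = κ.submatrix (c4 q r s t) (c4 q r s t) :=
    cancel_right uU (by rw [e24, e44])
  -- third column
  obtain ⟨e13, e23, e33, e43⟩ := E_rows hκ E (c3 q r s t)
  simp only [(colA _).2.2.1, (colB _).2.2.1, p12, p13, p22, p23, p32, p33, s12, s13, s22, s23, s32,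
    s33, Matrix.mul_zero, Matrix.zero_mul, Matrix.one_mul, Matrix.mul_one, zero_add, add_zero,
    Matrix.submatrix_zero, Pi.zero_apply, β0, ζ0] at e13 e23 e33 e43
  obtain ⟨e12, e22, e32, e42⟩ := E_rows hκ E (c2 q r s t)
  simp only [(colA _).2.2.2, (colB _).2.2.2, p12, p13, p22, p23, p32, p33, s12, s13, s22, s23, s32,
    s33, Matrix.mul_zero, Matrix.zero_mul, Matrix.one_mul, Matrix.mul_one, zero_add, add_zero,
    Matrix.submatrix_zero, Pi.zero_apply, β0, ζ0, e33] at e12 e22 e32 e42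
  obtain ⟨e11, e21, e31, e41⟩ := E_rows hκ E (c1 q r s t)
  simp only [(colA _).1, (colB _).1, Matrix.zero_mul, Matrix.one_mul, add_zero,
    β0, ζ0, e33] at e11 e21 e31 e41
  have α1 : κ.submatrix (r1 q r s t) (r1 q r s t) = 1 := by
    rw [Matrix.mul_add, ← Matrix.mul_assoc, e13, e32, Matrix.mul_one] at e12
    exact add_right_cancel e12
  rw [α1, Matrix.one_mul] at e13 e11
  rw [← δθ] at e42 e43 e41 e44
  have g3 : κ.submatrix (r2 q r s t) (r1 q r s t) * q₁.submatrix (c2 q r s t) (c3 q r s t) =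
      κ.submatrix (c4 q r s t) (c3 q r s t) := by
    rw [← e43] at e23
    exact add_right_cancel e23
  have γ0 : κ.submatrix (r2 q r s t) (r1 q r s t) = 0 := by
    rw [← e42] at e22
    have := add_right_cancel e22
    rw [Matrix.mul_add, Matrix.mul_one, ← Matrix.mul_assoc, g3] at this
    simpa using this
  have η0 : κ.submatrix (c4 q r s t) (c3 q r s t) = 0 := by
    rw [← g3, γ0, Matrix.zero_mul]
  rw [γ0, Matrix.zero_mul, zero_add] at e21 e22 e23
  rw [η0, Matrix.zero_mul, zero_add, Matrix.mul_add, e21] at e41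
  have δ1 := theta_one (ltU hb) (ltU hb') (dgU hb) (dgU hb') (ltT hb) (ltT hb') (dgT hb) e24
    (add_right_cancel e41)
  have κ1 : κ = 1 := by
    obtain ⟨o1, o2, o3, o4, o5, o6, o7, o8⟩ := one_blk (k := k) (q := q) (r := r) (s := s) (t := t)
    obtain ⟨⟨k1, k2⟩, ⟨k3, k4⟩, ⟨k5, k6⟩, ⟨k7, k8⟩⟩ := k_blk hκ
    obtain ⟨⟨l1, l2⟩, ⟨l3, l4⟩, ⟨l5, l6⟩, ⟨l7, l8⟩⟩ :=
      k_blk (one_mem (k := k) (q := q) (r := r) (s := s) (t := t))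
    refine ext_blk cases_r ⟨?_, ?_, ?_, ?_⟩ ⟨?_, ?_, ?_, ?_⟩ ⟨?_, ?_, ?_, ?_⟩ ⟨?_, ?_, ?_, ?_⟩
    · rw [α1, o1]
    · rw [β0, o2]
    · rw [k1, l1]
    · rw [k2, l2]
    · rw [γ0, o3]
    · rw [δ1, o4]
    · rw [k3, l3]
    · rw [k4, l4]
    · rw [k5, l5]
    · rw [k6, l6]
    · rw [e33, o5]
    · rw [ζ0, o6]
    · rw [k7, l7]
    · rw [k8, l8]
    · rw [η0, o7]
    · rw [← δθ, δ1, o8]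
  have hq1 : q₁ = q₁' := by
    ext i j
    by_cases h : inBlk (r + s) q (i : ℕ) ∧ inBlk ((r + s) + q) t (j : ℕ)
    · have := congrFun (congrFun e13 ⟨i - (r + s), by omega⟩) ⟨j - (r + s + q), by omega⟩
      have hi : c2 q r s t ⟨i - (r + s), by omega⟩ = i := by ext; simp only [c2]; omega
      have hj : c3 q r s t ⟨j - (r + s + q), by omega⟩ = j := by ext; simp only [c3]; omega
      simpa only [Matrix.submatrix_apply, hi, hj] using this
    · rw [hq i j h, hq' i j h]
  have hq2 : q₂ = q₂' := by
    ext i j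
    by_cases h : inBlk ((r + s) + q) t (i : ℕ) ∧ inBlk (r + s) q (j : ℕ)
    · have := congrFun (congrFun e32 ⟨i - (r + s + q), by omega⟩) ⟨j - (r + s), by omega⟩
      have hi : c2 q r s t ⟨j - (r + s), by omega⟩ = j := by ext; simp only [c2]; omega
      have hj : c3 q r s t ⟨i - (r + s + q), by omega⟩ = i := by ext; simp only [c3]; omega
      simpa only [Matrix.submatrix_apply, hi, hj] using this
    · rw [hh i j h, hh' i j h]
  refine ⟨?_, hq1, hq2, κ1⟩
  subst hq1 hq2
  rw [δ1, Matrix.one_mul] at e21 e22 e23 e24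
  have t11 := add_right_cancel e41
  rw [δ1, Matrix.one_mul] at t11
  have t11' : b₁.submatrix (c1 q r s t) (c1 q r s t) = b₂.submatrix (c1 q r s t) (c1 q r s t) := by
    ext i j
    simpa using congrFun (congrFun t11 i.rev) j
  have d42 : b₁.submatrix (c4 q r s t) (c2 q r s t) = b₂.submatrix (c4 q r s t) (c2 q r s t) := by
    rw [e23] at e22
    exact add_right_cancel e22
  have d43 : b₁.submatrix (c4 q r s t) (c3 q r s t) = b₂.submatrix (c4 q r s t) (c3 q r s t) := by
    rw [d42] at e23
    exact add_left_cancel e23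
  refine ext_blk cases_c ⟨t11', ?_, ?_, ?_⟩ ⟨e11, ?_, ?_, ?_⟩ ⟨e31, ?_, ?_, ?_⟩ ⟨e21, d42, d43, e24⟩
  · rw [p12, s12]
  · rw [p13, s13]
  · rw [p14, s14]
  · rw [p22, s22]
  · rw [p23, s23]
  · rw [p24, s24]
  · rw [p32, s32]
  · rw [p33, s33]
  · rw [p34, s34]

end S8

/-- If `b₁, b₂ ∈ B'`, `q₁, q₁' ∈ Q₁`, `q₂, q₂' ∈ Q₂`, `κ ∈ K` satisfy
`κ·o·b₁·q₁·q₂·o⁻¹ = o·b₂·q₁'·q₂'·o⁻¹`, then `b₁ = b₂`, `q₁ = q₁'`, `q₂ = q₂'` and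
`κ = 1`; i.e. `(b, q₁, q₂) ↦ K·o·b·q₁·q₂·o⁻¹` is injective. -/
theorem stmt8 (k : Type*) [Field k] (q r s t : ℕ)
    (hq : 1 ≤ q) (hr : 1 ≤ r) (hs : 1 ≤ s) (ht : 1 ≤ t) :
    ∀ b₁ ∈ bPrime k q r s t, ∀ b₂ ∈ bPrime k q r s t,
    ∀ q₁ ∈ qOne k q r s t, ∀ q₁' ∈ qOne k q r s t,
    ∀ q₂ ∈ qTwo k q r s t, ∀ q₂' ∈ qTwo k q r s t,
    ∀ κ ∈ kDiag k q r s t,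
      κ * (oMat k q r s t * b₁ * q₁ * q₂ * (oMat k q r s t)⁻¹) =
        oMat k q r s t * b₂ * q₁' * q₂' * (oMat k q r s t)⁻¹ →
      b₁ = b₂ ∧ q₁ = q₁' ∧ q₂ = q₂' ∧ κ = 1 := by
  intro b₁ hb b₂ hb' q₁ h1 q₁' h1' q₂ h2 q₂' h2' κ hκ E
  apply S8.main b₁ b₂ q₁ q₁' q₂ q₂' κ hb hb' h1 h1' h2 h2' hκ
  have hd := (Matrix.isUnit_iff_isUnit_det _).1 (S8.o_unit (k := k) (q := q) (r := r) (s := s) (t := t))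
  apply S8.cancel_right (U := (oMat k q r s t)⁻¹) (Matrix.isUnit_nonsing_inv_det _ hd)
  simpa only [Matrix.mul_assoc] using E
end

section
/- If b, b' ∈ B', q₁, q₁' ∈ Q₁ and q₂ ∈ Q₂ are such that o·b·q₁·q₂·q₁'·b'·o⁻¹ ∈ K, then b·q₁·q₂·q₁'·b' = 1; that is, oB'Q₁Q₂Q₁B'o⁻¹ ∩ K = {1}. -/
open Matrix

theorem mulRowDelta {k : Type*} [Field k] {n : ℕ} (A B : Matrix (Fin n) (Fin n) k) (i x j : Fin n)
    (h : ∀ l, A i l = if l = x then 1 else 0) : (A * B) i j = B x j := by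
  simp [Matrix.mul_apply, h]

theorem mulColDelta {k : Type*} [Field k] {n : ℕ} (A B : Matrix (Fin n) (Fin n) k) (i x j : Fin n)
    (h : ∀ l, B l j = if l = x then 1 else 0) : (A * B) i j = A i x := by
  simp [Matrix.mul_apply, h]

theorem mulRowDelta2 {k : Type*} [Field k] {n : ℕ} (A B : Matrix (Fin n) (Fin n) k)
    (i x y j : Fin n)
    (h : ∀ l, A i l = (if l = x then 1 else 0) + (if l = y then 1 else 0)) :
    (A * B) i j = B x j + B y j := by
  simp [Matrix.mul_apply, h, add_mul, Finset.sum_add_distrib]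

theorem mulColDelta2 {k : Type*} [Field k] {n : ℕ} (A B : Matrix (Fin n) (Fin n) k)
    (i x y j : Fin n)
    (h : ∀ l, B l j = (if l = x then 1 else 0) + (if l = y then 1 else 0)) :
    (A * B) i j = A i x + A i y := by
  simp [Matrix.mul_apply, h, mul_add, Finset.sum_add_distrib]

section
variable {k : Type*} [Field k] {q r s t : ℕ}


theorem oRow1 (g : Matrix (Fin (q + (r + s) + t + (r + s))) (Fin (q + (r + s) + t + (r + s))) k) (i x j : Fin (q + (r + s) + t + (r + s)))
    (hi : (i : ℕ) < q) (hx : (x : ℕ) = r + s + i) : (oMat k q r s t * g) i j = g x j := by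
  apply mulRowDelta
  intro l
  simp only [oMat, Matrix.of_apply, inBlk, Ipos, Jpos, Fin.ext_iff]
  apply if_congr _ rfl rfl
  omega

theorem oRow2 (g : Matrix (Fin (q + (r + s) + t + (r + s))) (Fin (q + (r + s) + t + (r + s))) k) (i x j : Fin (q + (r + s) + t + (r + s)))
    (hi : q ≤ (i : ℕ)) (hi' : (i : ℕ) < q + (r + s)) (hx : (x : ℕ) + q = r + s + q + t + i) :
    (oMat k q r s t * g) i j = g x j := by
  apply mulRowDelta
  intro l
  simp only [oMat, Matrix.of_apply, inBlk, Ipos, Jpos, Fin.ext_iff]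
  apply if_congr _ rfl rfl
  omega

theorem oRow3 (g : Matrix (Fin (q + (r + s) + t + (r + s))) (Fin (q + (r + s) + t + (r + s))) k) (i j : Fin (q + (r + s) + t + (r + s)))
    (hi : q + (r + s) ≤ (i : ℕ)) (hi' : (i : ℕ) < q + (r + s) + t) :
    (oMat k q r s t * g) i j = g i j := by
  apply mulRowDelta
  intro l
  simp only [oMat, Matrix.of_apply, inBlk, Ipos, Jpos, Fin.ext_iff]
  apply if_congr _ rfl rfl
  omega

theorem oRow4 (g : Matrix (Fin (q + (r + s) + t + (r + s))) (Fin (q + (r + s) + t + (r + s))) k) (i j : Fin (q + (r + s) + t + (r + s)))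
    (hi : q + (r + s) + t ≤ (i : ℕ)) (hq : 1 ≤ q) :
    (oMat k q r s t * g) i j = g i.rev j + g i j := by
  apply mulRowDelta2
  intro l
  simp only [oMat, Matrix.of_apply, inBlk, Ipos, Jpos, Fin.ext_iff, Fin.val_rev]
  split_ifs <;> first | omega | simp

theorem oCol1 (g : Matrix (Fin (q + (r + s) + t + (r + s))) (Fin (q + (r + s) + t + (r + s))) k) (i j : Fin (q + (r + s) + t + (r + s)))
    (hj : (j : ℕ) < r + s) : (g * oMat k q r s t) i j = g i j.rev := by
  apply mulColDelta
  intro l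
  simp only [oMat, Matrix.of_apply, inBlk, Ipos, Jpos, Fin.ext_iff, Fin.val_rev]
  apply if_congr _ rfl rfl
  omega

theorem oCol2 (g : Matrix (Fin (q + (r + s) + t + (r + s))) (Fin (q + (r + s) + t + (r + s))) k) (i x j : Fin (q + (r + s) + t + (r + s)))
    (hj : r + s ≤ (j : ℕ)) (hj' : (j : ℕ) < r + s + q) (hx : (x : ℕ) + (r + s) = j) :
    (g * oMat k q r s t) i j = g i x := by
  apply mulColDelta
  intro l
  simp only [oMat, Matrix.of_apply, inBlk, Ipos, Jpos, Fin.ext_iff]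
  apply if_congr _ rfl rfl
  omega

theorem oCol3 (g : Matrix (Fin (q + (r + s) + t + (r + s))) (Fin (q + (r + s) + t + (r + s))) k) (i j : Fin (q + (r + s) + t + (r + s)))
    (hj : r + s + q ≤ (j : ℕ)) (hj' : (j : ℕ) < r + s + q + t) :
    (g * oMat k q r s t) i j = g i j := by
  apply mulColDelta
  intro l
  simp only [oMat, Matrix.of_apply, inBlk, Ipos, Jpos, Fin.ext_iff]
  apply if_congr _ rfl rfl
  omega

theorem oCol4 (g : Matrix (Fin (q + (r + s) + t + (r + s))) (Fin (q + (r + s) + t + (r + s))) k) (i x j : Fin (q + (r + s) + t + (r + s)))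
    (hj : r + s + q + t ≤ (j : ℕ)) (hx : (x : ℕ) + (r + s + q + t) = q + j) (ht : 1 ≤ t) :
    (g * oMat k q r s t) i j = g i x + g i j := by
  apply mulColDelta2
  intro l
  simp only [oMat, Matrix.of_apply, inBlk, Ipos, Jpos, Fin.ext_iff]
  split_ifs <;> first | omega | simp

/-- Lower triangular plus the `K` conditions force the identity. -/
theorem lowerCase (hq : 1 ≤ q) (ht : 1 ≤ t)
    (g M : Matrix (Fin (q + (r + s) + t + (r + s))) (Fin (q + (r + s) + t + (r + s))) k) (hM : M * oMat k q r s t = oMat k q r s t * g)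
    (hK : ∀ i j : Fin (q + (r + s) + t + (r + s)), (((i : ℕ) < q + (r + s) ∧ q + (r + s) ≤ (j : ℕ)) ∨
      (q + (r + s) ≤ (i : ℕ) ∧ (j : ℕ) < q + (r + s))) → M i j = 0)
    (hlow : ∀ i j : Fin (q + (r + s) + t + (r + s)), (i : ℕ) < (j : ℕ) → g i j = 0)
    (hmid : ∀ i j : Fin (q + (r + s) + t + (r + s)), inBlk (r + s) (q + t) (i : ℕ) → inBlk (r + s) (q + t) (j : ℕ) →
      g i j = if (i : ℕ) = (j : ℕ) then 1 else 0)
    (hlast : ∀ i : Fin (q + (r + s) + t + (r + s)), (r + s) + q + t ≤ (i : ℕ) → g i i = 1) : g = 1 := by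
  have hE : ∀ i j, (M * oMat k q r s t) i j = (oMat k q r s t * g) i j := fun i j => by rw [hM]
  -- block (2,1)
  have h21 : ∀ i j : Fin (q + (r + s) + t + (r + s)), r + s ≤ (i : ℕ) → (i : ℕ) < r + s + q → (j : ℕ) < r + s →
      g i j = 0 := by
    intro i j h1 h2 h3
    have := hE ⟨i - (r + s), by omega⟩ j
    rw [oRow1 g _ i j (by simp; omega) (by simp; omega), oCol1 _ _ _ h3] at this
    rw [← this]
    apply hK
    simp only [Fin.val_rev]; omega
  have h31 : ∀ i j : Fin (q + (r + s) + t + (r + s)), r + s + q ≤ (i : ℕ) → (i : ℕ) < r + s + q + t → (j : ℕ) < r + s →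
      g i j = 0 := by
    intro i j h1 h2 h3
    have e1 := hE i j
    have e2 := hE i j.rev
    rw [oRow3 g _ _ (by omega) (by omega), oCol1 _ _ _ h3] at e1
    rw [oRow3 g _ _ (by omega) (by omega),
      oCol4 _ _ ⟨q + (r + s) - 1 - j, by omega⟩ _ (by simp only [Fin.val_rev]; omega)
        (by simp only [Fin.val_rev]; omega) ht,
      hK i ⟨q + (r + s) - 1 - j, by omega⟩ (by simp only []; omega), zero_add] at e2
    rw [← e1, e2]
    apply hlow
    simp only [Fin.val_rev]; omega
  have h41 : ∀ i j : Fin (q + (r + s) + t + (r + s)), r + s + q + t ≤ (i : ℕ) → (j : ℕ) < r + s → g i j = 0 := by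
    intro i j h1 h3
    have := hE ⟨i - (r + s + t), by omega⟩ j
    rw [oRow2 g _ i j (by simp only []; omega) (by simp only []; omega) (by simp only []; omega),
      oCol1 _ _ _ h3] at this
    rw [← this]
    apply hK
    simp only [Fin.val_rev]; omega
  have h43 : ∀ i j : Fin (q + (r + s) + t + (r + s)), r + s + q + t ≤ (i : ℕ) → r + s + q ≤ (j : ℕ) →
      (j : ℕ) < r + s + q + t → g i j = 0 := by
    intro i j h1 h3 h4
    have := hE ⟨i - (r + s + t), by omega⟩ j
    rw [oRow2 g _ i j (by simp only []; omega) (by simp only []; omega) (by simp only []; omega),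
      oCol3 _ _ _ h3 h4] at this
    rw [← this]
    apply hK
    simp only []; omega
  have h42 : ∀ i j : Fin (q + (r + s) + t + (r + s)), r + s + q + t ≤ (i : ℕ) → r + s ≤ (j : ℕ) →
      (j : ℕ) < r + s + q → g i j = 0 := by
    intro i j h1 h3 h4
    have := hE i j
    rw [oRow4 g i j (by omega) hq, oCol2 _ _ ⟨j - (r + s), by omega⟩ _ h3 h4 (by simp only []; omega),
      hK i _ (by simp only []; omega), hlow i.rev j (by simp only [Fin.val_rev]; omega),
      zero_add] at this
    exact this.symm
  have h11 : ∀ i j : Fin (q + (r + s) + t + (r + s)), (i : ℕ) < r + s → (j : ℕ) < r + s → g i j = g i.rev j.rev := by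
    intro i j h1 h3
    have e1 := hE i.rev j
    have e2 := hE i.rev j.rev
    rw [oRow4 g _ _ (by simp only [Fin.val_rev]; omega) hq, oCol1 _ _ _ h3, Fin.rev_rev,
      h41 i.rev j (by simp only [Fin.val_rev]; omega) h3, add_zero] at e1
    rw [oRow4 g _ _ (by simp only [Fin.val_rev]; omega) hq,
      oCol4 _ _ ⟨q + (r + s) - 1 - j, by omega⟩ _ (by simp only [Fin.val_rev]; omega)
        (by simp only [Fin.val_rev]; omega) ht,
      hK i.rev ⟨q + (r + s) - 1 - j, by omega⟩ (by simp only [Fin.val_rev]; omega), zero_add,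
      Fin.rev_rev, hlow i j.rev (by simp only [Fin.val_rev]; omega), zero_add] at e2
    rw [← e1, e2]
  ext i j
  rw [Matrix.one_apply]
  rcases lt_trichotomy (i : ℕ) (j : ℕ) with h | h | h
  · rw [hlow i j h, if_neg (by rw [Fin.ext_iff]; omega)]
  · have h' : i = j := Fin.ext h
    subst h'
    rw [if_pos rfl]
    by_cases c1 : (i : ℕ) < r + s
    · rw [h11 i i c1 c1]
      exact hlast _ (by simp only [Fin.val_rev]; omega)
    · by_cases c2 : r + s + q + t ≤ (i : ℕ)
      · exact hlast _ c2
      · rw [hmid i i ⟨by omega, by omega⟩ ⟨by omega, by omega⟩, if_pos rfl]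
  · rw [if_neg (by rw [Fin.ext_iff]; omega)]
    by_cases c1 : (i : ℕ) < r + s
    · rw [h11 i j c1 (by omega)]
      exact hlow _ _ (by simp only [Fin.val_rev]; omega)
    · by_cases c2 : r + s + q + t ≤ (j : ℕ)
      · have := h11 i.rev j.rev (by simp only [Fin.val_rev]; omega) (by simp only [Fin.val_rev]; omega)
        rw [Fin.rev_rev, Fin.rev_rev] at this
        rw [← this]
        exact hlow _ _ (by simp only [Fin.val_rev]; omega)
      · by_cases c3 : r + s + q + t ≤ (i : ℕ)
        · by_cases d1 : (j : ℕ) < r + s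
          · exact h41 i j c3 d1
          · by_cases d2 : (j : ℕ) < r + s + q
            · exact h42 i j c3 (by omega) d2
            · exact h43 i j c3 (by omega) (by omega)
        · by_cases d1 : (j : ℕ) < r + s
          · by_cases d2 : (i : ℕ) < r + s + q
            · exact h21 i j (by omega) d2 d1
            · exact h31 i j (by omega) (by omega) d1
          · rw [hmid i j ⟨by omega, by omega⟩ ⟨by omega, by omega⟩, if_neg (by omega)]

/-- The middle block of `b * m * b'` is that of `m`. -/
theorem midEntry (b m b' : Matrix (Fin (q + (r + s) + t + (r + s))) (Fin (q + (r + s) + t + (r + s))) k)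
    (hb : b ∈ bPrime k q r s t) (hb' : b' ∈ bPrime k q r s t)
    (hm : ∀ i j : Fin (q + (r + s) + t + (r + s)), ¬ (inBlk (r + s) (q + t) (i : ℕ) ∧ inBlk (r + s) (q + t) (j : ℕ)) →
      m i j = if (i : ℕ) = (j : ℕ) then 1 else 0)
    (i j : Fin (q + (r + s) + t + (r + s))) (hi : inBlk (r + s) (q + t) (i : ℕ)) (hj : inBlk (r + s) (q + t) (j : ℕ)) :
    (b * m * b') i j = m i j := by
  obtain ⟨bl, -, bm, -⟩ := hb
  obtain ⟨bl', -, bm', -⟩ := hb'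
  have e1 : (b * m) i j = m i j := by
    rw [Matrix.mul_apply, Finset.sum_eq_single i]
    · rw [bm i i hi hi, if_pos rfl, one_mul]
    · intro a _ ha
      by_cases h : inBlk (r + s) (q + t) (a : ℕ)
      · rw [bm i a hi h, if_neg (fun h => ha (Fin.ext h.symm)), zero_mul]
      · rw [hm a j (fun h' => h h'.1), if_neg (by simp only [inBlk] at h hj; omega), mul_zero]
    · simp
  rw [← e1, Matrix.mul_apply, Finset.sum_eq_single j]
  · rw [bm' j j hj hj, if_pos rfl, mul_one]
  · intro l _ hl
    by_cases h : inBlk (r + s) (q + t) (l : ℕ)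
    · rw [bm' l j h hj, if_neg (fun h => hl (Fin.ext h)), mul_zero]
    · by_cases h1 : (l : ℕ) < r + s
      · rw [bl' l j (lt_of_lt_of_le h1 hj.1), mul_zero]
      · have : (b * m) i l = b i l := by
          apply mulColDelta
          intro a
          rw [hm a l (fun h' => h h'.2)]
          simp only [Fin.ext_iff]
        rw [this, bl i l (by simp only [inBlk] at h hi; omega), zero_mul]
  · simp

end

/-- If `b, b' ∈ B'`, `q₁, q₁' ∈ Q₁` and `q₂ ∈ Q₂` are such that
`o·b·q₁·q₂·q₁'·b'·o⁻¹ ∈ K`, then `b·q₁·q₂·q₁'·b' = 1`; that is,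
`oB'Q₁Q₂Q₁B'o⁻¹ ∩ K = {1}`. -/
theorem stmt9 (k : Type*) [Field k] (q r s t : ℕ)
    (hq : 1 ≤ q) (hr : 1 ≤ r) (hs : 1 ≤ s) (ht : 1 ≤ t) :
    ∀ b ∈ bPrime k q r s t, ∀ b' ∈ bPrime k q r s t,
    ∀ q₁ ∈ qOne k q r s t, ∀ q₁' ∈ qOne k q r s t,
    ∀ q₂ ∈ qTwo k q r s t,
      oMat k q r s t * b * q₁ * q₂ * q₁' * b' * (oMat k q r s t)⁻¹ ∈ kDiag k q r s t →
      b * q₁ * q₂ * q₁' * b' = 1 := by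
  intro b hb b' hb' q₁ h1 q₁' h1' q₂ h2 hK
  obtain ⟨hU, hK⟩ := hK
  have hdet : IsUnit (oMat k q r s t).det := by
    rw [Matrix.isUnit_iff_isUnit_det, Matrix.det_mul] at hU
    exact Matrix.isUnit_nonsing_inv_det_iff.mp (isUnit_of_mul_isUnit_right hU)
  generalize hM : oMat k q r s t * b * q₁ * q₂ * q₁' * b' * (oMat k q r s t)⁻¹ = M at hK
  have hMo : M * oMat k q r s t = oMat k q r s t * (b * (q₁ * q₂ * q₁') * b') := by
    rw [← hM, Matrix.mul_assoc _ (oMat k q r s t)⁻¹, Matrix.nonsing_inv_mul _ hdet, Matrix.mul_one]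
    simp only [Matrix.mul_assoc]
  have hg : b * q₁ * q₂ * q₁' * b' = b * (q₁ * q₂ * q₁') * b' := by
    simp only [Matrix.mul_assoc]
  rw [hg]
  -- row and column descriptions of the factors
  have r1 : ∀ g ∈ qOne k q r s t, ∀ (X : Matrix (Fin (q + (r + s) + t + (r + s))) (Fin (q + (r + s) + t + (r + s))) k)
      (i j : Fin (q + (r + s) + t + (r + s))), ¬ inBlk (r + s) q (i : ℕ) →
      (g * X) i j = X i j := by
    intro g hg X i j hi
    apply mulRowDelta
    intro l
    rw [hg i l (fun h => hi h.1)]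
    simp only [Fin.ext_iff, eq_comm]
  have c1 : ∀ g ∈ qOne k q r s t, ∀ (X : Matrix (Fin (q + (r + s) + t + (r + s))) (Fin (q + (r + s) + t + (r + s))) k)
      (i j : Fin (q + (r + s) + t + (r + s))), ¬ inBlk (r + s + q) t (j : ℕ) →
      (X * g) i j = X i j := by
    intro g hg X i j hj
    apply mulColDelta
    intro l
    rw [hg l j (fun h => hj h.2)]
    simp only [Fin.ext_iff]
  have r2 : ∀ (X : Matrix (Fin (q + (r + s) + t + (r + s))) (Fin (q + (r + s) + t + (r + s))) k)
      (i j : Fin (q + (r + s) + t + (r + s))), ¬ inBlk (r + s + q) t (i : ℕ) →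
      (q₂ * X) i j = X i j := by
    intro X i j hi
    apply mulRowDelta
    intro l
    rw [h2 i l (fun h => hi h.1)]
    simp only [Fin.ext_iff, eq_comm]
  have c2 : ∀ (X : Matrix (Fin (q + (r + s) + t + (r + s))) (Fin (q + (r + s) + t + (r + s))) k)
      (i j : Fin (q + (r + s) + t + (r + s))), ¬ inBlk (r + s) q (j : ℕ) →
      (X * q₂) i j = X i j := by
    intro X i j hj
    apply mulColDelta
    intro l
    rw [h2 l j (fun h => hj h.2)]
    simp only [Fin.ext_iff]
  have hm : ∀ i j : Fin (q + (r + s) + t + (r + s)),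
      ¬ (inBlk (r + s) (q + t) (i : ℕ) ∧ inBlk (r + s) (q + t) (j : ℕ)) →
      (q₁ * q₂ * q₁') i j = if (i : ℕ) = (j : ℕ) then 1 else 0 := by
    intro i j hij
    by_cases hi : inBlk (r + s) (q + t) (i : ℕ)
    · have hj : ¬ inBlk (r + s) (q + t) (j : ℕ) := fun h => hij ⟨hi, h⟩
      simp only [inBlk] at hj
      rw [c1 q₁' h1' _ _ _ (by simp only [inBlk]; omega), c2 _ _ _ (by simp only [inBlk]; omega)]
      exact h1 i j (by simp only [inBlk]; omega)
    · simp only [inBlk] at hi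
      rw [Matrix.mul_assoc, r1 q₁ h1 _ _ _ (by simp only [inBlk]; omega),
        r2 _ _ _ (by simp only [inBlk]; omega)]
      exact h1' i j (by simp only [inBlk]; omega)
  have hmidE := midEntry b (q₁ * q₂ * q₁') b' hb hb' hm
  have hE : ∀ i j, (M * oMat k q r s t) i j
      = (oMat k q r s t * (b * (q₁ * q₂ * q₁') * b')) i j := fun i j => by rw [hMo]
  have hq2 : q₂ = 1 := by
    ext i j
    rw [Matrix.one_apply]
    by_cases h : inBlk (r + s + q) t (i : ℕ) ∧ inBlk (r + s) q (j : ℕ)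
    · obtain ⟨hi, hj⟩ := h
      simp only [inBlk] at hi hj
      have e := hE i j
      rw [oRow3 _ _ _ (by omega) (by omega),
        oCol2 _ _ ⟨j - (r + s), by omega⟩ _ (by omega) (by omega) (by simp only []; omega),
        hK i _ (by simp only []; omega),
        hmidE i j ⟨by omega, by omega⟩ ⟨by omega, by omega⟩,
        c1 q₁' h1' _ _ _ (by simp only [inBlk]; omega),
        r1 q₁ h1 _ _ _ (by simp only [inBlk]; omega)] at e
      rw [← e, if_neg (by rw [Fin.ext_iff]; omega)]
    · rw [h2 i j h]
      simp only [Fin.ext_iff]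
  have hm1 : q₁ * q₂ * q₁' = 1 := by
    ext i j
    rw [Matrix.one_apply]
    by_cases hi : inBlk (r + s) q (i : ℕ)
    · by_cases hj : inBlk (r + s + q) t (j : ℕ)
      · simp only [inBlk] at hi hj
        have e := hE ⟨i - (r + s), by omega⟩ j
        rw [oRow1 _ _ i _ (by simp only []; omega) (by simp only []; omega),
          oCol3 _ _ _ (by omega) (by omega),
          hK _ _ (by simp only []; omega),
          hmidE i j ⟨by omega, by omega⟩ ⟨by omega, by omega⟩] at e
        rw [← e, if_neg (by rw [Fin.ext_iff]; omega)]
      · rw [c1 q₁' h1' _ _ _ hj, hq2, Matrix.mul_one, h1 i j (fun h => hj h.2)]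
        simp only [Fin.ext_iff]
    · rw [Matrix.mul_assoc, r1 q₁ h1 _ _ _ hi, hq2, Matrix.one_mul, h1' i j (fun h => hi h.1)]
      simp only [Fin.ext_iff]
  rw [hm1] at hmidE hMo ⊢
  rw [Matrix.mul_one] at hmidE hMo ⊢
  obtain ⟨bl, -, -, bd⟩ := hb
  obtain ⟨bl', -, -, bd'⟩ := hb'
  refine lowerCase hq ht (b * b') M hMo hK ?_ ?_ ?_
  · intro i j hij
    rw [Matrix.mul_apply]
    apply Finset.sum_eq_zero
    intro l _
    by_cases h : (i : ℕ) < l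
    · rw [bl i l h, zero_mul]
    · rw [bl' l j (by omega), mul_zero]
  · intro i j hi hj
    rw [hmidE i j hi hj, Matrix.one_apply]
    simp only [Fin.ext_iff]
  · intro i hi
    rw [Matrix.mul_apply, Finset.sum_eq_single i]
    · rw [bd i hi, bd' i hi, one_mul]
    · intro l _ hl
      rw [Ne, Fin.ext_iff] at hl
      by_cases h : (i : ℕ) < l
      · rw [bl i l h, zero_mul]
      · rw [bl' l i (by omega), mul_zero]
    · simp
end
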